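/- Let (D,L) be a finite linear space and let A, B ⊆ D with A ≤ D and B ≤ D. Then A ∩ B ≤ D. Consequently, every subset X ⊆ D has a smallest superset icl(X) ⊆ D that is strong in D (the intrinsic closure of X in D). -/

import Mathlib

open scoped Classical

/-- A linear space: a set of points with a family of lines, each line having at
least 3 points, such that two distinct points lie on at most one line. -/
structure LinearSpace (M : Type*) where
  lines : Set (Set M)
  three_le : ∀ ℓ ∈ lines, ∃ x y z : M,
    x ∈ ℓ ∧ y ∈ ℓ ∧ z ∈ ℓ ∧ x ≠ y ∧ x ≠ z ∧ y ≠ z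
  unique_line : ∀ ⦃x y : M⦄, x ≠ y → ∀ ⦃ℓ₁ : Set M⦄, ℓ₁ ∈ lines →
    ∀ ⦃ℓ₂ : Set M⦄, ℓ₂ ∈ lines →
    x ∈ ℓ₁ → y ∈ ℓ₁ → x ∈ ℓ₂ → y ∈ ℓ₂ → ℓ₁ = ℓ₂

variable {M : Type*}

/-- The lines meeting a finite set `S` in at least two points. -/
def lineContrib (LS : LinearSpace M) (S : Finset M) : Set (Set M) :=
  {ℓ | ℓ ∈ LS.lines ∧ 2 ≤ (S.filter (· ∈ ℓ)).card}

lemma lineContrib_finite (LS : LinearSpace M) (S : Finset M) :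
    (lineContrib LS S).Finite := by
  have hinj : Set.InjOn (fun ℓ => S.filter (· ∈ ℓ)) (lineContrib LS S) := by
    rintro ℓ₁ ⟨h1, h1c⟩ ℓ₂ ⟨h2, h2c⟩ heq
    simp only at heq
    obtain ⟨x, hx, y, hy, hxy⟩ :=
      Finset.one_lt_card.mp (lt_of_lt_of_le one_lt_two h1c)
    have hx1 := Finset.mem_filter.mp hx
    have hy1 := Finset.mem_filter.mp hy
    have hx2 := Finset.mem_filter.mp (heq ▸ hx)
    have hy2 := Finset.mem_filter.mp (heq ▸ hy)
    exact LS.unique_line hxy h1 h2 hx1.2 hy1.2 hx2.2 hy2.2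
  have himg : (fun ℓ => S.filter (· ∈ ℓ)) '' lineContrib LS S ⊆ ↑S.powerset := by
    rintro t ⟨ℓ, -, rfl⟩
    exact Finset.mem_coe.mpr (Finset.mem_powerset.mpr (Finset.filter_subset _ S))
  exact Set.Finite.of_finite_image
    (Set.Finite.subset S.powerset.finite_toSet himg) hinj

/-- The predimension `δ(S) = |S| - Σ_ℓ max(|ℓ ∩ S| - 2, 0)` of a finite
subset of a linear space. -/
noncomputable def delta (LS : LinearSpace M) (S : Finset M) : ℤ :=
  (S.card : ℤ) -
    ∑ ℓ ∈ (lineContrib_finite LS S).toFinset, ((S.filter (· ∈ ℓ)).card - 2 : ℤ)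

/-- `S` is strong in `T` (written `S ≤ T`): `S ⊆ T` and `δ(X) ≥ δ(S)` for
every `X` with `S ⊆ X ⊆ T`. -/
def StrongIn (LS : LinearSpace M) (S T : Finset M) : Prop :=
  S ⊆ T ∧ ∀ X : Finset M, S ⊆ X → X ⊆ T → delta LS S ≤ delta LS X

lemma delta_eq_card_sub_sum (LS : LinearSpace M) (S : Finset M) (F : Finset (Set M))
    (hF : ∀ ℓ ∈ F, ℓ ∈ LS.lines) (hS : lineContrib LS S ⊆ ↑F) :
    delta LS S = (S.card : ℤ) - ∑ ℓ ∈ F, max ((S.filter (· ∈ ℓ)).card - 2 : ℤ) 0 := by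
  unfold delta
  congr 1
  have hsub : (lineContrib_finite LS S).toFinset ⊆ F := fun ℓ hℓ =>
    hS ((lineContrib_finite LS S).mem_toFinset.mp hℓ)
  rw [← Finset.sum_subset hsub]
  · refine Finset.sum_congr rfl fun ℓ hℓ => ?_
    have h := ((lineContrib_finite LS S).mem_toFinset.mp hℓ).2
    rw [max_eq_left]
    omega
  · intro ℓ hℓ hn
    have h : ¬ 2 ≤ (S.filter (· ∈ ℓ)).card := fun h =>
      hn ((lineContrib_finite LS S).mem_toFinset.mpr ⟨hF ℓ hℓ, h⟩)
    rw [max_eq_right]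
    omega

lemma lineContrib_mono (LS : LinearSpace M) {S T : Finset M} (h : S ⊆ T) :
    lineContrib LS S ⊆ lineContrib LS T := fun _ hℓ =>
  ⟨hℓ.1, hℓ.2.trans (Finset.card_le_card (Finset.filter_subset_filter _ h))⟩

/-- The predimension is submodular. -/
lemma delta_union_add_delta_inter_le (LS : LinearSpace M) (A B : Finset M) :
    delta LS (A ∪ B) + delta LS (A ∩ B) ≤ delta LS A + delta LS B := by
  set F := (lineContrib_finite LS (A ∪ B)).toFinset with hFdef
  have hF : ∀ ℓ ∈ F, ℓ ∈ LS.lines := fun ℓ hℓ =>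
    ((lineContrib_finite LS (A ∪ B)).mem_toFinset.mp hℓ).1
  have key : ∀ S ⊆ A ∪ B, delta LS S =
      (S.card : ℤ) - ∑ ℓ ∈ F, max ((S.filter (· ∈ ℓ)).card - 2 : ℤ) 0 := fun S hS =>
    delta_eq_card_sub_sum LS S F hF (by
      rw [hFdef, Set.Finite.coe_toFinset]
      exact lineContrib_mono LS hS)
  rw [key _ subset_rfl, key _ (Finset.inter_subset_left.trans Finset.subset_union_left),
    key A Finset.subset_union_left, key B Finset.subset_union_right]
  have hcard := Finset.card_union_add_card_inter A B
  have hsum : ∑ ℓ ∈ F, max ((A.filter (· ∈ ℓ)).card - 2 : ℤ) 0 +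
      ∑ ℓ ∈ F, max ((B.filter (· ∈ ℓ)).card - 2 : ℤ) 0 ≤
      ∑ ℓ ∈ F, max (((A ∪ B).filter (· ∈ ℓ)).card - 2 : ℤ) 0 +
      ∑ ℓ ∈ F, max (((A ∩ B).filter (· ∈ ℓ)).card - 2 : ℤ) 0 := by
    rw [← Finset.sum_add_distrib, ← Finset.sum_add_distrib]
    refine Finset.sum_le_sum fun ℓ _ => ?_
    have h := Finset.card_union_add_card_inter (A.filter (· ∈ ℓ)) (B.filter (· ∈ ℓ))
    rw [← Finset.filter_union, ← Finset.filter_inter_distrib] at h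
    have hA : (A.filter (· ∈ ℓ)).card ≤ ((A ∪ B).filter (· ∈ ℓ)).card :=
      Finset.card_le_card (Finset.filter_subset_filter _ Finset.subset_union_left)
    have hB : (B.filter (· ∈ ℓ)).card ≤ ((A ∪ B).filter (· ∈ ℓ)).card :=
      Finset.card_le_card (Finset.filter_subset_filter _ Finset.subset_union_right)
    omega
  omega

lemma StrongIn.delta_inter_le {LS : LinearSpace M} {A T X : Finset M} (hA : StrongIn LS A T)
    (hX : X ⊆ T) : delta LS (A ∩ X) ≤ delta LS X := by
  have h₁ := hA.2 (A ∪ X) Finset.subset_union_left (Finset.union_subset hA.1 hX)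
  have h₂ := delta_union_add_delta_inter_le LS A X
  omega

lemma StrongIn.inter {LS : LinearSpace M} {A B T : Finset M} (hA : StrongIn LS A T)
    (hB : StrongIn LS B T) : StrongIn LS (A ∩ B) T := by
  refine ⟨Finset.inter_subset_left.trans hA.1, fun X hX hXT => ?_⟩
  have h := (hA.delta_inter_le (Finset.inter_subset_right.trans hXT)).trans
    (hB.delta_inter_le hXT)
  rwa [← Finset.inter_assoc, Finset.inter_eq_left.mpr hX] at h

lemma StrongIn.refl (LS : LinearSpace M) (T : Finset M) : StrongIn LS T T :=
  ⟨subset_rfl, fun _ h₁ h₂ => (congrArg (delta LS) (h₁.antisymm h₂)).le⟩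

lemma exists_smallest_strongIn_superset (LS : LinearSpace M) {X T : Finset M} (hX : X ⊆ T) :
    ∃ C : Finset M, X ⊆ C ∧ StrongIn LS C T ∧
      ∀ Y : Finset M, X ⊆ Y → StrongIn LS Y T → C ⊆ Y := by
  obtain ⟨C, ⟨hXC, hC⟩, hmin⟩ := WellFounded.has_min (wellFounded_lt (α := Finset M))
    {C | X ⊆ C ∧ StrongIn LS C T} ⟨T, hX, StrongIn.refl LS T⟩
  refine ⟨C, hXC, hC, fun Y hXY hY => ?_⟩
  by_contra hCY
  refine hmin (C ∩ Y) ⟨Finset.subset_inter hXC hXY, hC.inter hY⟩ ?_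
  exact Finset.inter_subset_left.ssubset_of_ne fun h => hCY (Finset.inter_eq_left.mp h)

/-- In a finite linear space `D`, if `A ≤ D` and `B ≤ D` then
`A ∩ B ≤ D`; consequently every subset `X ⊆ D` has a smallest superset
`icl(X)` that is strong in `D` (the intrinsic closure of `X` in `D`). -/
theorem strong_inter_strong (M : Type*) [Fintype M] (LS : LinearSpace M) :
    (∀ A B : Finset M, StrongIn LS A Finset.univ → StrongIn LS B Finset.univ →
      StrongIn LS (A ∩ B) Finset.univ) ∧
    (∀ X : Finset M, ∃ icl : Finset M, X ⊆ icl ∧ StrongIn LS icl Finset.univ ∧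
      ∀ Y : Finset M, X ⊆ Y → StrongIn LS Y Finset.univ → icl ⊆ Y) := by
  exact ⟨fun _ _ hA hB => hA.inter hB, fun X =>
    exists_smallest_strongIn_superset LS X.subset_univ⟩
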